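/- arXiv:1209.3998 — 2 statements merged into one kernel-verified Lean document; each statement's English description precedes it below -/
import Mathlib

section
/- Let r be a classical solution of the axisymmetric surface diffusion flow on an open interval I. Then the surface area S(t) := ∫_{−π}^{π} r(t,x)√(1+(∂_x r(t,x))^2) dx is differentiable in t with S'(t) = − ∫_{−π}^{π} (r(t,x)/√(1+(∂_x r(t,x))^2))·(∂_x H(r(t,·))(x))^2 dx ≤ 0 for all t ∈ I; in particular t ↦ S(t) is nonincreasing on I (surface area is a Lyapunov functional for ASD). -/
open Real

/-- The (normalized) mean curvature of the surface of revolution with profile `r`. -/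
noncomputable def meanCurv (r : ℝ → ℝ) (x : ℝ) : ℝ :=
  1 / (r x * Real.sqrt (1 + (deriv r x) ^ 2)) -
    deriv (deriv r) x / (1 + (deriv r x) ^ 2) ^ ((3 : ℝ) / 2)

/-- The axisymmetric surface diffusion operator
`G(r)(x) = (1/r) ∂ₓ [ (r/√(1+r'²)) ∂ₓ H(r) ](x)`. -/
noncomputable def asdG (r : ℝ → ℝ) (x : ℝ) : ℝ :=
  (1 / r x) *
    deriv (fun y => r y / Real.sqrt (1 + (deriv r y) ^ 2) * deriv (meanCurv r) y) x

open scoped ContDiff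

/-- The derivative of a periodic function is periodic. -/
theorem Function.Periodic.deriv_real {f : ℝ → ℝ} {c : ℝ} (hf : Function.Periodic f c) :
    Function.Periodic (deriv f) c := fun x => by
  rw [← deriv_comp_add_const f c x, hf.funext]

/-- Differentiation under the integral sign for an integrand that is `C¹` on a strip. -/
theorem hasDerivAt_intervalIntegral_of_contDiffOn {a b c d t : ℝ} {F : ℝ × ℝ → ℝ}
    (hF : ContDiffOn ℝ 1 F (Set.Ioo a b ×ˢ Set.univ)) (ht : t ∈ Set.Ioo a b) :
    HasDerivAt (fun s => ∫ x in c..d, F (s, x)) (∫ x in c..d, fderiv ℝ F (t, x) (1, 0)) t := by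
  have hU : IsOpen (Set.Ioo a b ×ˢ (Set.univ : Set ℝ)) := isOpen_Ioo.prod isOpen_univ
  have hF' : ContinuousOn (fun p => fderiv ℝ F p (1, 0)) (Set.Ioo a b ×ˢ Set.univ) :=
    (hF.continuousOn_fderiv_of_isOpen hU le_rfl).clm_apply continuousOn_const
  have slice {G : ℝ × ℝ → ℝ} (hG : ContinuousOn G (Set.Ioo a b ×ˢ Set.univ)) {s : ℝ}
      (hs : s ∈ Set.Ioo a b) : Continuous fun x => G (s, x) :=
    hG.comp_continuous (by fun_prop) fun x => ⟨hs, Set.mem_univ x⟩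
  obtain ⟨ε, hε, hball⟩ := Metric.nhds_basis_closedBall.mem_iff.1 (isOpen_Ioo.mem_nhds ht)
  obtain ⟨C, hC⟩ := ((isCompact_closedBall t ε).prod isCompact_uIcc).exists_bound_of_continuousOn
    (hF'.mono (Set.prod_mono hball (Set.subset_univ (Set.uIcc c d))))
  refine (intervalIntegral.hasDerivAt_integral_of_dominated_loc_of_deriv_le
    (F := fun s x => F (s, x)) (F' := fun s x => fderiv ℝ F (s, x) (1, 0)) (bound := fun _ => C)
    (Metric.closedBall_mem_nhds t hε) ?_ ?_ ?_ ?_ ?_ ?_).2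
  · filter_upwards [isOpen_Ioo.mem_nhds ht] with s hs
    exact (slice hF.continuousOn hs).aestronglyMeasurable
  · exact (slice hF.continuousOn ht).intervalIntegrable _ _
  · exact (slice hF' ht).aestronglyMeasurable
  · exact .of_forall fun x hx s hs => hC (s, x) ⟨hs, Set.uIoc_subset_uIcc hx⟩
  · exact intervalIntegrable_const
  · refine .of_forall fun x _ s hs => ?_
    have hmem : (s, x) ∈ Set.Ioo a b ×ˢ (Set.univ : Set ℝ) := ⟨hball hs, Set.mem_univ x⟩
    exact ((hF.contDiffAt (hU.mem_nhds hmem)).differentiableAt one_ne_zero)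
      |>.hasFDerivAt.comp_hasDerivAt s ((hasDerivAt_id s).prodMk (hasDerivAt_const s x))

/-- The mean curvature of a smooth positive profile is smooth. -/
theorem ContDiff.meanCurv {f : ℝ → ℝ} (hf : ContDiff ℝ ∞ f) (hpos : ∀ x, 0 < f x) :
    ContDiff ℝ ∞ (meanCurv f) := by
  have hf' := (contDiff_infty_iff_deriv.1 hf).2
  have hf'' := (contDiff_infty_iff_deriv.1 hf').2
  have hq : ContDiff ℝ ∞ fun x => 1 + deriv f x ^ 2 := contDiff_const.add (hf'.pow 2)
  have hq0 (x : ℝ) : 0 < 1 + deriv f x ^ 2 := by positivity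
  exact (contDiff_const.div (hf.mul (hq.sqrt fun x => (hq0 x).ne'))
    fun x => (mul_pos (hpos x) (sqrt_pos.2 (hq0 x))).ne').sub
    (hf''.div (hq.rpow_const_of_ne fun x => (hq0 x).ne') fun x => (rpow_pos_of_pos (hq0 x) _).ne')

/-- The mean curvature of a periodic profile is periodic. -/
theorem Function.Periodic.meanCurv {f : ℝ → ℝ} {c : ℝ} (hf : Function.Periodic f c) :
    Function.Periodic (meanCurv f) c := fun x => by
  simp only [_root_.meanCurv, hf x, hf.deriv_real x, hf.deriv_real.deriv_real x]

/-- The first variation of the area of a surface of revolution, in divergence form: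
the variation of the area density is `v f H(f)` up to a derivative. -/
theorem hasDerivAt_area_flux {f v : ℝ → ℝ} {v' x : ℝ} (hf : ContDiff ℝ ∞ f)
    (hpos : 0 < f x) (hv : HasDerivAt v v' x) :
    HasDerivAt (fun y => f y * deriv f y * v y / √(1 + deriv f y ^ 2))
      (v x * √(1 + deriv f x ^ 2) + f x * deriv f x * v' / √(1 + deriv f x ^ 2) -
        v x * f x * meanCurv f x) x := by
  have hf' := (contDiff_infty_iff_deriv.1 hf).2
  have h1 : HasDerivAt f (deriv f x) x := (hf.differentiable (by simp) x).hasDerivAt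
  have h2 : HasDerivAt (deriv f) (deriv (deriv f) x) x :=
    (hf'.differentiable (by simp) x).hasDerivAt
  have hq0 : 0 < 1 + deriv f x ^ 2 := by positivity
  have hq := ((h2.pow 2).const_add 1).sqrt hq0.ne'
  refine (((h1.mul h2).mul hv).div hq (sqrt_pos.2 hq0).ne').congr_deriv ?_
  have hrpow : (1 + deriv f x ^ 2) ^ ((3 : ℝ) / 2) = √(1 + deriv f x ^ 2) ^ 3 := by
    rw [show (3 : ℝ) / 2 = 1 / 2 * (3 : ℕ) by norm_num, rpow_mul hq0.le, ← sqrt_eq_rpow,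
      rpow_natCast]
  rw [meanCurv, hrpow]
  simp only [Pi.mul_apply, Pi.pow_apply]
  have hsq : √(1 + deriv f x ^ 2) ^ 2 = 1 + deriv f x ^ 2 := sq_sqrt hq0.le
  have hs := sqrt_pos.2 hq0
  generalize √(1 + deriv f x ^ 2) = q at *
  generalize deriv f x = p at *
  field_simp
  norm_num
  linear_combination 2 * v x * (f x * deriv (deriv f) x - q ^ 2) * hsq

/-- Along a radial variation `v` satisfying `f v = ∂ₓ (f / √(1 + f'²) ∂ₓ H(f))` the first variation
of the area over one period is `-∫ f / √(1 + f'²) (∂ₓ H(f))²`. -/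
theorem integral_area_variation {f v : ℝ → ℝ} {c d : ℝ} (hf : ContDiff ℝ ∞ f)
    (hpos : ∀ x, 0 < f x) (hper : Function.Periodic f (d - c)) (hv : ContDiff ℝ ∞ v)
    (hvper : Function.Periodic v (d - c)) (hflow : ∀ x, v x = asdG f x) :
    ∫ x in c..d, (v x * √(1 + deriv f x ^ 2) + f x * deriv f x * deriv v x / √(1 + deriv f x ^ 2)) =
      -∫ x in c..d, f x / √(1 + deriv f x ^ 2) * deriv (meanCurv f) x ^ 2 := by
  have hf' := (contDiff_infty_iff_deriv.1 hf).2
  have hH := hf.meanCurv hpos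
  have hH' := (contDiff_infty_iff_deriv.1 hH).2
  have hv' := (contDiff_infty_iff_deriv.1 hv).2
  have hq0 (x : ℝ) : 0 < 1 + deriv f x ^ 2 := by positivity
  have hq : ContDiff ℝ ∞ fun x => √(1 + deriv f x ^ 2) :=
    (contDiff_const.add (hf'.pow 2)).sqrt fun x => (hq0 x).ne'
  have hqne (x : ℝ) : √(1 + deriv f x ^ 2) ≠ 0 := (sqrt_pos.2 (hq0 x)).ne'
  have hW : ContDiff ℝ ∞ fun y => f y / √(1 + deriv f y ^ 2) * deriv (meanCurv f) y :=
    (hf.div hq hqne).mul hH'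
  have hderiv (x : ℝ) : HasDerivAt
      (fun y => f y * deriv f y * v y / √(1 + deriv f y ^ 2) +
        f y / √(1 + deriv f y ^ 2) * deriv (meanCurv f) y * meanCurv f y)
      ((v x * √(1 + deriv f x ^ 2) + f x * deriv f x * deriv v x / √(1 + deriv f x ^ 2)) +
        f x / √(1 + deriv f x ^ 2) * deriv (meanCurv f) x ^ 2) x := by
    refine ((hasDerivAt_area_flux hf (hpos x) (hv.differentiable (by simp) x).hasDerivAt).add
      (((hW.differentiable (by simp) x).hasDerivAt).mul
        (hH.differentiable (by simp) x).hasDerivAt)).congr_deriv ?_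
    have h := hflow x
    rw [asdG, one_div, eq_inv_mul_iff_mul_eq₀ (hpos x).ne'] at h
    rw [← h]
    ring
  have hI : Continuous fun x =>
      v x * √(1 + deriv f x ^ 2) + f x * deriv f x * deriv v x / √(1 + deriv f x ^ 2) :=
    (hv.continuous.mul hq.continuous).add
      (((hf.continuous.mul hf'.continuous).mul hv'.continuous).div hq.continuous hqne)
  have hJ : Continuous fun x => f x / √(1 + deriv f x ^ 2) * deriv (meanCurv f) x ^ 2 :=
    (hf.continuous.div hq.continuous hqne).mul (hH'.continuous.pow 2)
  rw [eq_neg_iff_add_eq_zero, ← intervalIntegral.integral_add (hI.intervalIntegrable _ _)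
    (hJ.intervalIntegrable _ _), intervalIntegral.integral_eq_sub_of_hasDerivAt
    (fun x _ => hderiv x) ((hI.add hJ).intervalIntegrable _ _), sub_eq_zero]
  have hend {g : ℝ → ℝ} (hg : Function.Periodic g (d - c)) : g d = g c := by
    simpa using hg c
  rw [hend hper, hend hper.deriv_real, hend hvper, hend hper.meanCurv,
    hend hper.meanCurv.deriv_real]

/-- The derivative in the first variable of the area density `u √(1 + (∂₂ u)²)`, with the mixed
partial derivative written as `∂₂ (∂₁ u)`. -/
theorem fderiv_area_density {u : ℝ × ℝ → ℝ} {t x : ℝ} (hu : ContDiffAt ℝ ∞ u (t, x)) :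
    fderiv ℝ (fun p => u p * √(1 + fderiv ℝ u p (0, 1) ^ 2)) (t, x) (1, 0) =
      fderiv ℝ u (t, x) (1, 0) * √(1 + fderiv ℝ u (t, x) (0, 1) ^ 2) +
        u (t, x) * fderiv ℝ u (t, x) (0, 1) * deriv (fun y => fderiv ℝ u (t, y) (1, 0)) x /
          √(1 + fderiv ℝ u (t, x) (0, 1) ^ 2) := by
  have hD := (hu.differentiableAt (by simp)).hasFDerivAt
  have hDD := ((hu.fderiv_right (m := ∞) (by simp)).differentiableAt (by simp)).hasFDerivAt
  have hmixed : HasDerivAt (fun y => fderiv ℝ u (t, y) (1, 0))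
      (fderiv ℝ (fderiv ℝ u) (t, x) (0, 1) (1, 0)) x := by
    simpa using (hDD.comp_hasDerivAt x ((hasDerivAt_const x t).prodMk (hasDerivAt_id x))).clm_apply
      (hasDerivAt_const x ((1 : ℝ), (0 : ℝ)))
  have hux := hDD.clm_apply (hasFDerivAt_const ((0 : ℝ), (1 : ℝ)) (t, x))
  have hsymm := hu.isSymmSndFDerivAt
    (by simpa using WithTop.coe_le_coe.2 (le_top : (2 : ℕ∞) ≤ ⊤)) ((1 : ℝ), (0 : ℝ)) ((0 : ℝ), (1 : ℝ))
  have hq0 : 0 < 1 + fderiv ℝ u (t, x) (0, 1) ^ 2 := by positivity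
  have hs := (sqrt_pos.2 hq0).ne'
  have hF := hD.mul (((hux.pow 2).const_add 1).sqrt hq0.ne')
  rw [hmixed.deriv, ← hsymm]
  refine (congrArg (fun L : ℝ × ℝ →L[ℝ] ℝ => L (1, 0)) hF.fderiv).trans ?_
  simp
  field_simp
  ring

/-- Along a classical solution of the axisymmetric surface diffusion flow on `(a, b)`, the
surface area `S(t) = ∫_{-π}^{π} r(t,x)√(1+(∂ₓr)²) dx` is differentiable with derivative
`-∫ (r/√(1+r'²)) (∂ₓ H(r(t,·)))² dx ≤ 0`; in particular `S` is nonincreasing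
(surface area is a Lyapunov functional for ASD). -/
theorem asd_area_lyapunov (a b : ℝ) (r : ℝ → ℝ → ℝ)
    (hr : ContDiffOn ℝ (⊤ : ℕ∞) (fun p : ℝ × ℝ => r p.1 p.2) (Set.Ioo a b ×ˢ Set.univ))
    (hpos : ∀ t ∈ Set.Ioo a b, ∀ x : ℝ, 0 < r t x)
    (hper : ∀ t ∈ Set.Ioo a b, ∀ x : ℝ, r t (x + 2 * Real.pi) = r t x)
    (hflow : ∀ t ∈ Set.Ioo a b, ∀ x : ℝ, deriv (fun s => r s x) t = asdG (r t) x) :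
    (∀ t ∈ Set.Ioo a b,
      HasDerivAt
        (fun s => ∫ x in (-Real.pi)..Real.pi, r s x * Real.sqrt (1 + (deriv (r s) x) ^ 2))
        (-∫ x in (-Real.pi)..Real.pi,
            r t x / Real.sqrt (1 + (deriv (r t) x) ^ 2) * (deriv (meanCurv (r t)) x) ^ 2) t ∧
      (-∫ x in (-Real.pi)..Real.pi,
          r t x / Real.sqrt (1 + (deriv (r t) x) ^ 2) * (deriv (meanCurv (r t)) x) ^ 2) ≤ 0) ∧
    ∀ t₁ ∈ Set.Ioo a b, ∀ t₂ ∈ Set.Ioo a b, t₁ ≤ t₂ →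
      (∫ x in (-Real.pi)..Real.pi, r t₂ x * Real.sqrt (1 + (deriv (r t₂) x) ^ 2)) ≤
        ∫ x in (-Real.pi)..Real.pi, r t₁ x * Real.sqrt (1 + (deriv (r t₁) x) ^ 2) := by
  have hU : IsOpen (Set.Ioo a b ×ˢ (Set.univ : Set ℝ)) := isOpen_Ioo.prod isOpen_univ
  have hmem {t : ℝ} (ht : t ∈ Set.Ioo a b) (x : ℝ) :
      (t, x) ∈ Set.Ioo a b ×ˢ (Set.univ : Set ℝ) := ⟨ht, Set.mem_univ x⟩
  set u : ℝ × ℝ → ℝ := fun p => r p.1 p.2 with hu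
  have hDu : ContDiffOn ℝ ∞ (fderiv ℝ u) (Set.Ioo a b ×ˢ Set.univ) :=
    hr.fderiv_of_isOpen hU (by simp)
  have hux : ContDiffOn ℝ ∞ (fun p => fderiv ℝ u p (0, 1)) (Set.Ioo a b ×ˢ Set.univ) :=
    hDu.clm_apply contDiffOn_const
  have hline {t : ℝ} (x : ℝ) : HasDerivAt (fun y : ℝ => (t, y)) ((0 : ℝ), (1 : ℝ)) x :=
    (hasDerivAt_const x t).prodMk (hasDerivAt_id x)
  have hline' {t : ℝ} (x : ℝ) : HasDerivAt (fun s : ℝ => (s, x)) ((1 : ℝ), (0 : ℝ)) t :=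
    (hasDerivAt_id t).prodMk (hasDerivAt_const t x)
  have hDat {t : ℝ} (ht : t ∈ Set.Ioo a b) (x : ℝ) :
      HasFDerivAt u (fderiv ℝ u (t, x)) (t, x) :=
    ((hr.contDiffAt (hU.mem_nhds (hmem ht x))).differentiableAt (by simp)).hasFDerivAt
  have hrx {t : ℝ} (ht : t ∈ Set.Ioo a b) (x : ℝ) :
      deriv (r t) x = fderiv ℝ u (t, x) (0, 1) :=
    ((hDat ht x).comp_hasDerivAt x (hline x)).deriv
  have hrt {t : ℝ} (ht : t ∈ Set.Ioo a b) (x : ℝ) :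
      HasDerivAt (fun s => r s x) (fderiv ℝ u (t, x) (1, 0)) t :=
    HasFDerivAt.comp_hasDerivAt (l := u) t (hDat ht x) (hline' x)
  have harea : ContDiffOn ℝ 1 (fun p => u p * √(1 + fderiv ℝ u p (0, 1) ^ 2))
      (Set.Ioo a b ×ˢ Set.univ) :=
    (hr.mul ((contDiffOn_const.add (hux.pow 2)).sqrt fun p _ => by positivity)).of_le (by simp)
  have main (t : ℝ) (ht : t ∈ Set.Ioo a b) : HasDerivAt
      (fun s => ∫ x in (-π)..π, r s x * √(1 + deriv (r s) x ^ 2))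
      (-∫ x in (-π)..π, r t x / √(1 + deriv (r t) x ^ 2) * deriv (meanCurv (r t)) x ^ 2) t := by
    have hslice : ContDiff ℝ ∞ (r t) :=
      hr.comp_contDiff (g := u) (f := fun x => (t, x)) (by fun_prop) fun x => hmem ht x
    have hv : ContDiff ℝ ∞ fun x => fderiv ℝ u (t, x) (1, 0) :=
      (hDu.comp_contDiff (f := fun x => (t, x)) (by fun_prop) fun x => hmem ht x).clm_apply
        contDiff_const
    have hvper : Function.Periodic (fun x => fderiv ℝ u (t, x) (1, 0)) (π - -π) := fun x => by
      refine (hrt ht (x + (π - -π))).unique ((hrt ht x).congr_of_eventuallyEq ?_)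
      filter_upwards [isOpen_Ioo.mem_nhds ht] with s hs
      rw [← hper s hs x]
      ring_nf
    have hvar := integral_area_variation (c := -π) (d := π) hslice (hpos t ht)
      (fun x => by rw [← hper t ht x]; ring_nf) hv hvper
      fun x => by rw [← hflow t ht x, (hrt ht x).deriv]
    rw [← hvar]
    refine ((hasDerivAt_intervalIntegral_of_contDiffOn harea ht).congr_of_eventuallyEq
      ?_).congr_deriv (intervalIntegral.integral_congr fun x _ => ?_)
    · filter_upwards [isOpen_Ioo.mem_nhds ht] with s hs
      simp only [hrx hs, hu]
    · simpa only [hrx ht x] using fderiv_area_density (hr.contDiffAt (hU.mem_nhds (hmem ht x)))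
  have nonpos (t : ℝ) (ht : t ∈ Set.Ioo a b) :
      (-∫ x in (-π)..π, r t x / √(1 + deriv (r t) x ^ 2) * deriv (meanCurv (r t)) x ^ 2) ≤ 0 :=
    neg_nonpos.2 <| intervalIntegral.integral_nonneg (by linarith [pi_pos]) fun x _ =>
      mul_nonneg (div_nonneg (hpos t ht x).le (sqrt_nonneg _)) (sq_nonneg _)
  refine ⟨fun t ht => ⟨main t ht, nonpos t ht⟩, ?_⟩
  refine antitoneOn_of_deriv_nonpos (convex_Ioo a b)
    (fun t ht => (main t ht).continuousAt.continuousWithinAt)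
    (fun t ht => (main t (interior_subset ht)).differentiableAt.differentiableWithinAt)
    fun t ht => ?_
  rw [(main t (interior_subset ht)).deriv]
  exact nonpos t (interior_subset ht)
end

section
/- Let r : ℝ → ℝ be smooth, 2π-periodic (r(x+2π) = r(x) for all x), positive, and nonconstant, and suppose there is a constant H₀ ∈ ℝ with H(r)(x) = H₀ for all x ∈ ℝ. Then H₀ > 0, and there exist B ∈ (−1,1) with B ≠ 0 and x₀ ∈ ℝ such that r(x₀ + x_{H₀,B}(s)) = y_{H₀,B}(s) for all s ∈ ℝ. (Every nonconstant periodic positive profile of constant mean curvature is, up to translation along the axis, an undulary curve from the Delaunay–Kenmotsu family.) -/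
open Real

/-- The second (radial) component of the Kenmotsu profile curve. -/
noncomputable def kenY (H B s : ℝ) : ℝ :=
  Real.sqrt (1 + B ^ 2 + 2 * B * Real.sin (H * s)) / H

/-- The first (axial) component of the Kenmotsu profile curve. -/
noncomputable def kenX (H B s : ℝ) : ℝ :=
  ∫ t in (Real.pi / (2 * H))..s,
    (1 + B * Real.sin (H * t)) / Real.sqrt (1 + B ^ 2 + 2 * B * Real.sin (H * t))

/-- A smooth profile of constant mean curvature `H`, written as a second order ODE for `r` in
terms of the length element `√(1 + r'²)`. -/
theorem ode_of_meanCurv_eq {r : ℝ → ℝ} {H x : ℝ} (hpos : 0 < r x) (h : meanCurv r x = H) :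
    r x * deriv (deriv r) x / √(1 + deriv r x ^ 2) ^ 3 = 1 / √(1 + deriv r x ^ 2) - H * r x := by
  have hw : 0 < 1 + deriv r x ^ 2 := by positivity
  have hW : 0 < √(1 + deriv r x ^ 2) := Real.sqrt_pos.2 hw
  have h3 : (1 + deriv r x ^ 2) ^ ((3 : ℝ) / 2) = √(1 + deriv r x ^ 2) ^ 3 := by
    rw [Real.sqrt_eq_rpow, ← Real.rpow_natCast (_ ^ (1 / 2 : ℝ)), ← Real.rpow_mul hw.le]
    norm_num
  rw [meanCurv, h3] at h
  rw [← h]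
  field_simp
  ring

/-- The length element `√(1 + r'²)` of a graph is differentiable. -/
theorem hasDerivAt_sqrt_one_add_deriv_sq {r : ℝ → ℝ} {x : ℝ}
    (hr : DifferentiableAt ℝ (deriv r) x) :
    HasDerivAt (fun y => √(1 + deriv r y ^ 2))
      (deriv r x * deriv (deriv r) x / √(1 + deriv r x ^ 2)) x := by
  have hw : 0 < 1 + deriv r x ^ 2 := by positivity
  refine (((hr.hasDerivAt.pow 2).const_add 1).sqrt hw.ne').congr_deriv ?_
  have hW : 0 < √(1 + deriv r x ^ 2) := Real.sqrt_pos.2 hw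
  norm_num
  field_simp

/-- For a profile of constant mean curvature, derivative of `r r' / √(1 + r'²)`. -/
theorem hasDerivAt_mul_deriv_div_sqrt {r : ℝ → ℝ} {H x : ℝ} (hr : DifferentiableAt ℝ r x)
    (hr' : DifferentiableAt ℝ (deriv r) x) (hpos : 0 < r x) (h : meanCurv r x = H) :
    HasDerivAt (fun y => r y * deriv r y / √(1 + deriv r y ^ 2))
      (√(1 + deriv r x ^ 2) - H * r x) x := by
  have hw : 0 < 1 + deriv r x ^ 2 := by positivity
  have hW : 0 < √(1 + deriv r x ^ 2) := Real.sqrt_pos.2 hw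
  refine ((hr.hasDerivAt.mul hr'.hasDerivAt).div
    (hasDerivAt_sqrt_one_add_deriv_sq hr') hW.ne').congr_deriv ?_
  have hode := ode_of_meanCurv_eq hpos h
  have hsq := Real.sq_sqrt hw.le
  set W := √(1 + deriv r x ^ 2)
  have hHr : H * r x = 1 / W - r x * deriv (deriv r) x / W ^ 3 := by linarith
  have hd : deriv r x ^ 2 = W ^ 2 - 1 := by linarith
  simp only [Pi.mul_apply]
  rw [hHr]
  field_simp
  linear_combination (W ^ 2 - r x * deriv (deriv r) x) * hd

/-- For a profile of constant mean curvature, derivative of `r / √(1 + r'²)`. -/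
theorem hasDerivAt_div_sqrt {r : ℝ → ℝ} {H x : ℝ} (hr : DifferentiableAt ℝ r x)
    (hr' : DifferentiableAt ℝ (deriv r) x) (hpos : 0 < r x) (h : meanCurv r x = H) :
    HasDerivAt (fun y => r y / √(1 + deriv r y ^ 2)) (H * r x * deriv r x) x := by
  have hw : 0 < 1 + deriv r x ^ 2 := by positivity
  have hW : 0 < √(1 + deriv r x ^ 2) := Real.sqrt_pos.2 hw
  refine (hr.hasDerivAt.div
    (hasDerivAt_sqrt_one_add_deriv_sq hr') hW.ne').congr_deriv ?_
  have hode := ode_of_meanCurv_eq hpos h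
  set W := √(1 + deriv r x ^ 2)
  have hHr : H * r x = 1 / W - r x * deriv (deriv r) x / W ^ 3 := by linarith
  rw [hHr]
  field_simp

/-- The arc length of a graph, measured from `a`, takes every real value. -/
theorem surjective_integral_of_one_le {W : ℝ → ℝ} (hW : Continuous W) (h1 : ∀ x, 1 ≤ W x)
    (a c : ℝ) : Function.Surjective fun x => c + ∫ t in a..x, W t := by
  have hmono : Monotone fun x => (c + ∫ t in a..x, W t) - x := by
    refine monotone_of_hasDerivAt_nonneg (f' := fun x => W x - 1) (fun x => ?_) fun x => ?_
    · exact ((hW.integral_hasStrictDerivAt a x).hasDerivAt.const_add c).sub (hasDerivAt_id x)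
    · simpa using h1 x
  refine Continuous.surjective ?_ ?_ ?_
  · exact continuous_const.add (intervalIntegral.continuous_primitive
      (fun _ _ => hW.intervalIntegrable _ _) a)
  · refine Filter.tendsto_atTop_mono' _ ?_ (Filter.tendsto_atTop_add_const_right _ (c - a)
      Filter.tendsto_id)
    filter_upwards [Filter.eventually_ge_atTop a] with x hx
    have := hmono hx
    simp only [intervalIntegral.integral_same, id] at this ⊢
    linarith
  · refine Filter.tendsto_atBot_mono' _ ?_ (Filter.tendsto_atBot_add_const_right _ (c - a)
      Filter.tendsto_id)
    filter_upwards [Filter.eventually_le_atBot a] with x hx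
    have := hmono hx
    simp only [intervalIntegral.integral_same, id] at this ⊢
    linarith

/-- The radicand in the Kenmotsu profile is positive for `|B| < 1`. -/
theorem kenmotsu_radicand_pos {B : ℝ} (hB : B ∈ Set.Ioo (-1 : ℝ) 1) (t : ℝ) :
    0 < 1 + B ^ 2 + 2 * B * Real.sin t := by
  have h1 := Real.sin_sq_add_cos_sq t
  have h2 : 0 < 1 + B * Real.sin t := by
    have h3 : |B * Real.sin t| < 1 := by
      rw [abs_mul]
      exact mul_lt_one_of_nonneg_of_lt_one_left (abs_nonneg B) (abs_lt.2 hB) (Real.abs_sin_le_one t)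
    linarith [(abs_lt.1 h3).1]
  nlinarith [sq_nonneg (B * Real.cos t), mul_pos h2 h2]

theorem hasDerivAt_kenX {H B : ℝ} (hB : B ∈ Set.Ioo (-1 : ℝ) 1) (s : ℝ) :
    HasDerivAt (kenX H B)
      ((1 + B * Real.sin (H * s)) / √(1 + B ^ 2 + 2 * B * Real.sin (H * s))) s := by
  have hc : Continuous fun t : ℝ =>
      (1 + B * Real.sin (H * t)) / √(1 + B ^ 2 + 2 * B * Real.sin (H * t)) := by
    refine Continuous.div (by fun_prop) (by fun_prop) fun t => ?_
    exact (Real.sqrt_pos.2 (kenmotsu_radicand_pos hB _)).ne'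
  exact (hc.integral_hasStrictDerivAt _ s).hasDerivAt

/-- Every nonconstant, positive, smooth `2π`-periodic profile of constant mean curvature
`H₀` satisfies `H₀ > 0` and is, up to a translation along the axis, an undulary curve from
the Delaunay–Kenmotsu family: `r(x₀ + x_{H₀,B}(s)) = y_{H₀,B}(s)` for some `B ∈ (-1,1)`,
`B ≠ 0`. -/
theorem cmc_profile_is_undulary (r : ℝ → ℝ)
    (hr : ContDiff ℝ (⊤ : ℕ∞) r)
    (hper : ∀ x, r (x + 2 * Real.pi) = r x)
    (hpos : ∀ x, 0 < r x)
    (hnc : ∃ x y : ℝ, r x ≠ r y)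
    (H₀ : ℝ) (hcmc : ∀ x : ℝ, meanCurv r x = H₀) :
    0 < H₀ ∧
      ∃ B : ℝ, B ∈ Set.Ioo (-1 : ℝ) 1 ∧ B ≠ 0 ∧
        ∃ x₀ : ℝ, ∀ s : ℝ, r (x₀ + kenX H₀ B s) = kenY H₀ B s := by
  have hd : Differentiable ℝ r := hr.differentiable (by simp)
  have hr' : ContDiff ℝ (⊤ : ℕ∞) (deriv r) := (contDiff_infty_iff_deriv.1 hr).2
  have hd' : Differentiable ℝ (deriv r) := hr'.differentiable (by simp)
  set W : ℝ → ℝ := fun x => √(1 + deriv r x ^ 2) with hWdef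
  set P : ℝ → ℝ := fun x => r x * deriv r x / W x with hPdef
  set Q : ℝ → ℝ := fun x => r x / W x with hQdef
  have hWc : Continuous W := by
    have := hd'.continuous
    fun_prop
  have hW1 : ∀ x, 1 ≤ W x := fun x => Real.one_le_sqrt.2 (by nlinarith [sq_nonneg (deriv r x)])
  have hW0 : ∀ x, 0 < W x := fun x => one_pos.trans_le (hW1 x)
  have hWsq : ∀ x, W x ^ 2 = 1 + deriv r x ^ 2 := fun x => Real.sq_sqrt (by positivity)
  have hQ0 : ∀ x, 0 < Q x := fun x => div_pos (hpos x) (hW0 x)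
  have hP' : ∀ x, HasDerivAt P (W x - H₀ * r x) x := fun x =>
    hasDerivAt_mul_deriv_div_sqrt (hd x) (hd' x) (hpos x) (hcmc x)
  have hQ' : ∀ x, HasDerivAt Q (H₀ * r x * deriv r x) x := fun x =>
    hasDerivAt_div_sqrt (hd x) (hd' x) (hpos x) (hcmc x)
  have hPQ : ∀ x, P x ^ 2 + Q x ^ 2 = r x ^ 2 := fun x => by
    have := (hW0 x).ne'
    simp only [hPdef, hQdef]
    field_simp
    rw [hWsq]
    ring
  have hH : 0 < H₀ := by
    by_contra! hH
    have hmono : StrictMono P := strictMono_of_hasDerivAt_pos hP' fun x => by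
      nlinarith [hW0 x, hpos x]
    have hderiv : deriv r (0 + 2 * Real.pi) = deriv r 0 := by
      rw [← deriv_comp_add_const]
      simp only [hper]
    have hP : P (0 + 2 * Real.pi) = P 0 := by
      simp only [hPdef, hWdef, hderiv, hper]
    exact (hmono (by positivity : (0 : ℝ) < 0 + 2 * Real.pi)).ne' hP
  obtain ⟨x₀, -, hx₀⟩ : ∃ c ∈ Set.Ioo 0 (2 * Real.pi), deriv r c = 0 :=
    exists_deriv_eq_zero (by positivity) hd.continuous.continuousOn (by simpa using (hper 0).symm)
  set S : ℝ → ℝ := fun x => Real.pi / (2 * H₀) + ∫ t in x₀..x, W t with hSdef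
  have hS : Function.Surjective S := surjective_integral_of_one_le hWc hW1 _ _
  have hS' : ∀ x, HasDerivAt S (W x) x := fun x =>
    (hWc.integral_hasStrictDerivAt x₀ x).hasDerivAt.const_add _
  have hS₀ : S x₀ = Real.pi / (2 * H₀) := by simp [hSdef]
  have hHS₀ : H₀ * S x₀ = Real.pi / 2 := by
    rw [hS₀]
    field_simp
  set B : ℝ := H₀ * r x₀ - 1 with hBdef
  have hsin : ∀ x, HasDerivAt (fun y => Real.sin (H₀ * S y))
      (Real.cos (H₀ * S x) * (H₀ * W x)) x := fun x => ((hS' x).const_mul H₀).sin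
  have hcos : ∀ x, HasDerivAt (fun y => Real.cos (H₀ * S y))
      (-Real.sin (H₀ * S x) * (H₀ * W x)) x := fun x => ((hS' x).const_mul H₀).cos
  set E : ℝ → ℝ := fun x => (H₀ * P x - B * Real.cos (H₀ * S x)) ^ 2 +
    (H₀ * Q x - (1 + B * Real.sin (H₀ * S x))) ^ 2 with hEdef
  have hE' : ∀ x, HasDerivAt E 0 x := fun x => by
    refine (((((hP' x).const_mul H₀).sub ((hcos x).const_mul B)).pow 2).add
      ((((hQ' x).const_mul H₀).sub (((hsin x).const_mul B).const_add 1)).pow 2)).congr_deriv ?_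
    have hPW : r x * deriv r x = P x * W x := by
      simp only [hPdef]
      field_simp [(hW0 x).ne']
    have hQW : r x = Q x * W x := by
      simp only [hQdef]
      field_simp [(hW0 x).ne']
    simp only [Pi.sub_apply]
    rw [mul_assoc H₀ (r x), hPW, hQW]
    push_cast
    ring
  have hE : ∀ x, E x = 0 := fun x => by
    have hc := is_const_of_deriv_eq_zero (fun y => (hE' y).differentiableAt)
      (fun y => (hE' y).deriv) x x₀
    rw [hc]
    simp only [hEdef, hHS₀, hPdef, hQdef, hWdef, hx₀, hBdef]
    simp
  have hPS : ∀ x, H₀ * P x = B * Real.cos (H₀ * S x) := fun x => by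
    have := hE x
    simp only [hEdef] at this
    nlinarith [sq_nonneg (H₀ * P x - B * Real.cos (H₀ * S x)),
      sq_nonneg (H₀ * Q x - (1 + B * Real.sin (H₀ * S x)))]
  have hQS : ∀ x, H₀ * Q x = 1 + B * Real.sin (H₀ * S x) := fun x => by
    have := hE x
    simp only [hEdef, hPS x] at this
    have h0 : (H₀ * Q x - (1 + B * Real.sin (H₀ * S x))) ^ 2 = 0 := by linarith
    linarith [pow_eq_zero_iff two_ne_zero |>.1 h0]
  have hrad : ∀ x, 1 + B ^ 2 + 2 * B * Real.sin (H₀ * S x) = (H₀ * r x) ^ 2 := fun x => by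
    have h : (H₀ * r x) ^ 2 = (H₀ * P x) ^ 2 + (H₀ * Q x) ^ 2 := by
      linear_combination (-H₀ ^ 2) * hPQ x
    rw [h, hPS, hQS]
    linear_combination (-B ^ 2) * Real.sin_sq_add_cos_sq (H₀ * S x)
  have hsqrt : ∀ x, √(1 + B ^ 2 + 2 * B * Real.sin (H₀ * S x)) = H₀ * r x := fun x => by
    rw [hrad, Real.sqrt_sq (mul_pos hH (hpos x)).le]
  have hB : B ∈ Set.Ioo (-1 : ℝ) 1 := by
    constructor
    · have := mul_pos hH (hpos x₀)
      linarith
    · obtain ⟨x, hx⟩ := hS (-(Real.pi / 2) / H₀)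
      have h1 := hQS x
      rw [hx, mul_div_cancel₀ _ hH.ne', Real.sin_neg, Real.sin_pi_div_two] at h1
      linarith [mul_pos hH (hQ0 x)]
  refine ⟨hH, B, hB, ?_, x₀, ?_⟩
  · intro hB0
    obtain ⟨x, y, hxy⟩ := hnc
    have hx := hsqrt x
    have hy := hsqrt y
    simp only [hB0, mul_zero, zero_mul] at hx hy
    exact hxy (mul_left_cancel₀ hH.ne' (hx.symm.trans hy))
  · have hX' : ∀ x, HasDerivAt (fun y => kenX H₀ B (S y) - y) 0 x := fun x => by
      refine (((hasDerivAt_kenX hB (S x)).comp x (hS' x)).sub (hasDerivAt_id x)).congr_deriv ?_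
      rw [hsqrt, ← hQS]
      simp only [hQdef]
      have := (hW0 x).ne'
      have := (hpos x).ne'
      field_simp
      ring
    intro s
    obtain ⟨x, rfl⟩ := hS s
    have hX : kenX H₀ B (S x) - x = kenX H₀ B (S x₀) - x₀ :=
      is_const_of_deriv_eq_zero (fun y => (hX' y).differentiableAt) (fun y => (hX' y).deriv) x x₀
    have hX₀ : kenX H₀ B (S x₀) = 0 := by
      rw [hS₀, kenX, intervalIntegral.integral_same]
    have hx : x₀ + kenX H₀ B (S x) = x := by linarith
    rw [hx, kenY, hsqrt, mul_div_cancel_left₀ _ hH.ne']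
end
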